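/- arXiv:math/0509524 — 2 statements merged into one kernel-verified Lean document; each statement's English description precedes it below -/
import Mathlib

section
/- For every nonempty word v = m₁…m_n ∈ 𝕌 with a_{m_k} > 0 for all 1 ≤ k ≤ n: (a) A(v)/B(v) ≤ 1/(1 − a₊); and (b) for every integer p ≥ 1, the p-th derivative of f_v at 1 satisfies f_v^{(p)}(1) ≤ p! · a_v · (d/u)^n · (1 − a₊)^{1−p}. -/
/-- The map `f(x) = u/(1 - d x)` with `u = 1/2 + ε`, `d = 1/2 - ε`. -/
noncomputable def fstep (ε : ℝ) (x : ℝ) : ℝ := (1/2 + ε) / (1 - (1/2 - ε) * x)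

/-- `f_i(x) = f(1 - a_i + a_i x)`. -/
noncomputable def fi (ε : ℝ) (a : ℕ+ → ℝ) (i : ℕ+) (x : ℝ) : ℝ :=
  fstep ε (1 - a i + a i * x)

/-- For a word `v = m₁…m_n`, `f_v = f_{m₁} ∘ ⋯ ∘ f_{m_n}` (with `f_∅ = id`). -/
noncomputable def fword (ε : ℝ) (a : ℕ+ → ℝ) (v : List ℕ+) : ℝ → ℝ :=
  v.foldr (fun m g => fi ε a m ∘ g) id

/-- `a_v = a_{m₁} ⋯ a_{m_n}` (with `a_∅ = 1`). -/
noncomputable def aword (a : ℕ+ → ℝ) (v : List ℕ+) : ℝ := (v.map a).prod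

/-- `B(v) = (u/d)^n / a_v`. -/
noncomputable def Bword (ε : ℝ) (a : ℕ+ → ℝ) (v : List ℕ+) : ℝ :=
  ((1/2+ε)/(1/2-ε))^(v.length) / aword a v

/-- `A(v) = 1 + (u/d)/a_{m₁} + (u/d)²/(a_{m₁}a_{m₂}) + ⋯ + (u/d)^{n−1}/(a_{m₁}⋯a_{m_{n−1}})`. -/
noncomputable def Aword (ε : ℝ) (a : ℕ+ → ℝ) (v : List ℕ+) : ℝ :=
  ∑ k ∈ Finset.range v.length, ((1/2+ε)/(1/2-ε))^k / aword a (v.take k)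
theorem aword_cons (a : ℕ+ → ℝ) (m : ℕ+) (w : List ℕ+) :
    aword a (m :: w) = a m * aword a w := by
  simp [aword]

theorem aword_pos {a : ℕ+ → ℝ} {v : List ℕ+} (h : ∀ m ∈ v, 0 < a m) : 0 < aword a v :=
  List.prod_pos (by simpa using h)

theorem Bword_cons (ε : ℝ) (a : ℕ+ → ℝ) (m : ℕ+) (w : List ℕ+) :
    Bword ε a (m :: w) = (1/2 + ε) / (1/2 - ε) / a m * Bword ε a w := by
  simp only [Bword, aword_cons, List.length_cons, pow_succ']
  rw [mul_div_mul_comm]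

theorem Aword_cons (ε : ℝ) (a : ℕ+ → ℝ) (m : ℕ+) (w : List ℕ+) :
    Aword ε a (m :: w) = 1 + (1/2 + ε) / (1/2 - ε) / a m * Aword ε a w := by
  simp only [Aword, List.length_cons]
  rw [Finset.sum_range_succ', add_comm, Finset.mul_sum]
  congr 1
  · simp [aword]
  · refine Finset.sum_congr rfl fun k _ => ?_
    rw [List.take_succ_cons, aword_cons, pow_succ', mul_div_mul_comm]

theorem one_lt_ratio {ε : ℝ} (hε : ε ∈ Set.Ioo (0:ℝ) (1/2)) :
    1 < (1/2 + ε) / (1/2 - ε) := by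
  obtain ⟨h0, h1⟩ := hε
  rw [lt_div_iff₀ (by linarith)]
  linarith

theorem Bword_pos {ε : ℝ} (hε : ε ∈ Set.Ioo (0:ℝ) (1/2)) {a : ℕ+ → ℝ} {v : List ℕ+}
    (h : ∀ m ∈ v, 0 < a m) : 0 < Bword ε a v :=
  div_pos (pow_pos (zero_lt_one.trans (one_lt_ratio hε)) _) (aword_pos h)

theorem inv_Bword (ε : ℝ) (a : ℕ+ → ℝ) (v : List ℕ+) :
    (Bword ε a v)⁻¹ = aword a v * ((1/2 - ε) / (1/2 + ε)) ^ v.length := by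
  rw [Bword, inv_div, div_eq_mul_inv, ← inv_pow, inv_div]

theorem Aword_nonneg {ε : ℝ} (hε : ε ∈ Set.Ioo (0:ℝ) (1/2)) {a : ℕ+ → ℝ} {v : List ℕ+}
    (h : ∀ m ∈ v, 0 < a m) : 0 ≤ Aword ε a v :=
  Finset.sum_nonneg fun _ _ =>
    div_nonneg (pow_nonneg (zero_lt_one.trans (one_lt_ratio hε)).le _)
      (aword_pos fun m hm => h m (List.mem_of_mem_take hm)).le

theorem Aword_pos {ε : ℝ} (hε : ε ∈ Set.Ioo (0:ℝ) (1/2)) {a : ℕ+ → ℝ} {v : List ℕ+}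
    (hv : v ≠ []) (h : ∀ m ∈ v, 0 < a m) : 0 < Aword ε a v := by
  obtain ⟨m, w, rfl⟩ := List.exists_cons_of_ne_nil hv
  rw [List.forall_mem_cons] at h
  have := zero_lt_one.trans (one_lt_ratio hε)
  have := Aword_nonneg hε h.2
  have := h.1
  rw [Aword_cons]
  positivity

theorem mul_Aword_add_one_le_Bword {ε : ℝ} (hε : ε ∈ Set.Ioo (0:ℝ) (1/2)) {a : ℕ+ → ℝ}
    {c : ℝ} (hac : ∀ i, a i ≤ c) (v : List ℕ+) (h : ∀ m ∈ v, 0 < a m) :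
    (1 - c) * Aword ε a v + 1 ≤ Bword ε a v := by
  induction v with
  | nil => simp [Aword, Bword, aword]
  | cons m w ih =>
    rw [List.forall_mem_cons] at h
    have ihw := ih h.2
    rw [Aword_cons, Bword_cons]
    have hs : 2 - c ≤ (1/2 + ε) / (1/2 - ε) / a m := by
      rw [le_div_iff₀ h.1]
      nlinarith [hac m, h.1, one_lt_ratio hε, sq_nonneg (a m - 1)]
    have hs0 : 0 < (1/2 + ε) / (1/2 - ε) / a m :=
      div_pos (zero_lt_one.trans (one_lt_ratio hε)) h.1
    nlinarith [mul_le_mul_of_nonneg_left ihw hs0.le]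

theorem fword_eventuallyEq {ε : ℝ} (hε : ε ∈ Set.Ioo (0:ℝ) (1/2)) {a : ℕ+ → ℝ}
    (v : List ℕ+) (h : ∀ m ∈ v, 0 < a m) :
    fword ε a v =ᶠ[nhds 1] fun x => 1 - (1 - x) / (Aword ε a v * (1 - x) + Bword ε a v) := by
  have den_pos (w : List ℕ+) (hw : ∀ m ∈ w, 0 < a m) :
      ∀ᶠ x : ℝ in nhds 1, 0 < Aword ε a w * (1 - x) + Bword ε a w := by
    have hc : ContinuousAt (fun x : ℝ => Aword ε a w * (1 - x) + Bword ε a w) 1 := by fun_prop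
    exact hc.eventually_const_lt (by simpa using Bword_pos hε hw)
  induction v with
  | nil => exact Filter.Eventually.of_forall fun x => by simp [fword, Aword, Bword, aword]
  | cons m w ih =>
    have hd := den_pos _ h
    rw [List.forall_mem_cons] at h
    filter_upwards [ih h.2, den_pos w h.2, hd] with x hx hw hmw
    change fi ε a m (fword ε a w x) = _
    rw [hx, fi, fstep]
    rw [Aword_cons, Bword_cons] at hmw ⊢
    obtain ⟨h0, h1⟩ := hε
    have hm := h.1
    have hd0 : 0 < 1/2 - ε := by linarith
    set A := Aword ε a w
    set B := Bword ε a w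
    set D := A * (1 - x) + B with hD
    set s := (1/2 + ε) / (1/2 - ε) / a m with hs
    have hsm : s * (a m * (1/2 - ε)) = 1/2 + ε := by
      rw [hs, div_div, mul_comm (a m)]
      exact div_mul_cancel₀ _ (by positivity)
    have e1 : (1 + s * A) * (1 - x) + s * B = (1 - x) + s * D := by rw [hD]; ring
    rw [e1] at hmw ⊢
    have e2 : 1 - (1/2 - ε) * (1 - a m + a m * (1 - (1 - x) / D)) =
        a m * (1/2 - ε) * ((1 - x) + s * D) / D := by
      rw [eq_div_iff hw.ne']
      have : (1 - x) / D * D = 1 - x := div_mul_cancel₀ _ hw.ne'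
      linear_combination a m * (1/2 - ε) * this - D * hsm
    rw [e2, ← hsm]
    clear_value s D
    generalize 1/2 - ε = δ at hd0 ⊢
    generalize 1 - x = y at hmw ⊢
    field_simp
    ring

theorem iteratedDeriv_one_sub_div {A B : ℝ} (hA : A ≠ 0) (hB : 0 < B) {p : ℕ} (hp : 1 ≤ p) :
    iteratedDeriv p (fun x : ℝ => 1 - (1 - x) / (A * (1 - x) + B)) 1 =
      p.factorial * B⁻¹ * (A / B) ^ (p - 1) := by
  have key : (fun x : ℝ => 1 - (1 - x) / (A * (1 - x) + B)) =ᶠ[nhds 1]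
      fun x => (1 - 1 / A) + B / A * (-A * x + (A + B))⁻¹ := by
    have hc : ContinuousAt (fun x : ℝ => A * (1 - x) + B) 1 := by fun_prop
    filter_upwards [hc.eventually_ne (y := 0) (by simpa using hB.ne')] with x hx
    rw [show -A * x + (A + B) = A * (1 - x) + B by ring]
    linear_combination -A⁻¹ * mul_inv_cancel₀ hx +
      (1 - x) * (A * (1 - x) + B)⁻¹ * mul_inv_cancel₀ hA
  rw [key.iteratedDeriv_eq, iteratedDeriv_const_add hp, iteratedDeriv_const_mul_field,
    iteratedDeriv_eq_iterate, iter_deriv_inv_linear]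
  obtain ⟨k, rfl⟩ := Nat.exists_eq_add_of_le' hp
  have e : (-1 - ((k + 1 : ℕ) : ℤ)) = -((k + 2 : ℕ) : ℤ) := by push_cast; ring
  have e1 : (-1 : ℝ) ^ (k + 1) * (-A) ^ (k + 1) = A ^ (k + 1) := by
    rw [← mul_pow]; simp
  beta_reduce
  rw [e, zpow_neg, zpow_natCast, Nat.add_sub_cancel]
  rw [show -A * 1 + (A + B) = B by ring, mul_right_comm ((-1 : ℝ) ^ (k + 1)), e1, div_pow]
  field_simp
  ring

/-- For every nonempty word `v` with all letters of positive weight: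
(a) `A(v)/B(v) ≤ 1/(1 − a₊)`; and (b) for every `p ≥ 1`,
`f_v^{(p)}(1) ≤ p! · a_v · (d/u)^n · (1 − a₊)^{1−p}`. -/
theorem stmt4 (ε : ℝ) (hε : ε ∈ Set.Ioo (0:ℝ) (1/2))
    (a : ℕ+ → ℝ) (ha0 : ∀ i, 0 ≤ a i) (ha1 : ∀ i, a i < 1) (hsum : HasSum a 1)
    (haplus : (⨆ i, a i) < 1)
    (v : List ℕ+) (hv : v ≠ []) (hpos : ∀ m ∈ v, 0 < a m) :
    Aword ε a v / Bword ε a v ≤ 1 / (1 - (⨆ i, a i)) ∧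
    ∀ p : ℕ, 1 ≤ p →
      iteratedDeriv p (fword ε a v) 1 ≤
        (p.factorial : ℝ) * aword a v * ((1/2-ε)/(1/2+ε))^v.length *
          (1 - (⨆ i, a i)) ^ (1 - (p : ℤ)) := by
  have hbdd : BddAbove (Set.range a) := ⟨1, by rintro _ ⟨i, rfl⟩; exact (ha1 i).le⟩
  have hc : 0 < 1 - ⨆ i, a i := by linarith
  have hB := Bword_pos hε hpos
  have hA := Aword_pos hε hv hpos
  have hAB : Aword ε a v / Bword ε a v ≤ 1 / (1 - ⨆ i, a i) := by
    rw [div_le_div_iff₀ hB hc]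
    linarith [mul_Aword_add_one_le_Bword hε (le_ciSup hbdd) v hpos]
  refine ⟨hAB, fun p hp => ?_⟩
  rw [(fword_eventuallyEq hε v hpos).iteratedDeriv_eq, iteratedDeriv_one_sub_div hA.ne' hB hp,
    mul_assoc (p.factorial : ℝ) (aword a v), ← inv_Bword]
  have e : (1 - ⨆ i, a i) ^ (1 - (p : ℤ)) = (1 / (1 - ⨆ i, a i)) ^ (p - 1) := by
    rw [one_div, ← zpow_natCast, inv_zpow', Nat.cast_sub hp]
    simp
  rw [e]
  gcongr
end

section
/- With the uniform weights a_i = 1/b for 1 ≤ i ≤ b and a_i = 0 for i > b, one has lim_{ε→0+} (1 − d_ε/u_ε) · ∑_{v∈𝕌} ( 1 − f^{(ε)}_v(0) ) = 1 − 1/b; equivalently, γ_ε defined by 1/γ_ε = (1 − d_ε/u_ε)∑_{v∈𝕌}(1 − f^{(ε)}_v(0)) converges to (1 − 1/b)^{−1} = b/(b−1) as ε → 0+. -/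
open Filter

/-- In the coordinate `y = 1 - x`, `f_i` acts as `y ↦ d a_i y / (u + d a_i y)`. -/
lemma one_sub_fi (ε : ℝ) (a : ℕ+ → ℝ) (i : ℕ+) (x : ℝ)
    (h : (1/2 + ε) + (1/2 - ε) * (a i * (1 - x)) ≠ 0) :
    1 - fi ε a i x =
      (1/2 - ε) * (a i * (1 - x)) / ((1/2 + ε) + (1/2 - ε) * (a i * (1 - x))) := by
  have e : 1 - (1/2 - ε) * (1 - a i + a i * x) =
      (1/2 + ε) + (1/2 - ε) * (a i * (1 - x)) := by ring
  rw [fi, fstep, e, eq_div_iff h, sub_mul, div_mul_cancel₀ _ h]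
  ring

/-- For a word `v`, the value `1 - f_v(0)` depends only on the length of `v` if all letters are at
most `b`, and vanishes otherwise. -/
lemma one_sub_fword_zero {b : ℕ} (hb : 2 ≤ b) {a : ℕ+ → ℝ}
    (ha : ∀ i : ℕ+, a i = if (i : ℕ) ≤ b then (1 : ℝ) / b else 0)
    {ε : ℝ} (h0 : 0 < ε) (h1 : ε < 1/2) (v : List ℕ+) :
    1 - fword ε a v 0 = if ∀ m ∈ v, (m : ℕ) ≤ b then
      (∑ i ∈ Finset.range (v.length + 1), (b * ((1/2 + ε) / (1/2 - ε))) ^ i)⁻¹ else 0 := by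
  have hd : 0 < 1/2 - ε := by linarith
  have hb' : (0 : ℝ) < b := by positivity
  induction v with
  | nil => simp [fword]
  | cons m v ih =>
    have hw : fword ε a (m :: v) 0 = fi ε a m (fword ε a v 0) := rfl
    have hr : 0 < b * ((1/2 + ε) / (1/2 - ε)) := by positivity
    set r := b * ((1/2 + ε) / (1/2 - ε)) with hr_def
    have hz : 0 < ∑ i ∈ Finset.range (v.length + 1), r ^ i :=
      Finset.sum_pos (fun i _ => by positivity) (by simp)
    have ha0 : 0 ≤ a m := by rw [ha]; split_ifs <;> positivity
    have hy0 : 0 ≤ 1 - fword ε a v 0 := by rw [ih]; split_ifs <;> positivity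
    have hpos : 0 < (1/2 + ε) + (1/2 - ε) * (a m * (1 - fword ε a v 0)) := by positivity
    rw [hw, one_sub_fi _ _ _ _ hpos.ne', ih, ha m]
    by_cases hm : (m : ℕ) ≤ b
    · by_cases hv : ∀ m ∈ v, (m : ℕ) ≤ b
      · rw [if_pos hm, if_pos hv, if_pos (by simpa using ⟨hm, hv⟩), List.length_cons,
          geom_sum_succ (n := v.length + 1)]
        generalize ∑ i ∈ Finset.range (v.length + 1), r ^ i = z at hz
        have hru : (1/2 - ε) * r = b * (1/2 + ε) := by
          rw [hr_def, mul_left_comm, mul_div_assoc', mul_div_cancel_left₀ _ hd.ne']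
        have hzr : 0 < r * z + 1 := by positivity
        rw [← one_div (r * z + 1), div_eq_div_iff (by positivity) hzr.ne']
        field_simp
        linear_combination 2 * z * hru
      · have hv' : ¬ ∀ x ∈ m :: v, (x : ℕ) ≤ b :=
          fun h => hv fun x hx => h x (List.mem_cons_of_mem _ hx)
        rw [if_neg hv, if_neg hv']
        simp
    · have hm' : ¬ ∀ x ∈ m :: v, (x : ℕ) ≤ b := fun h => hm (h m List.mem_cons_self)
      rw [if_neg hm, if_neg hm']
      simp

/-- Summation over words of a function that only depends on the length of words over the
alphabet `{1, …, b}` and vanishes on all other words. -/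
lemma tsum_words_eq {b : ℕ} (hb : 0 < b) {y : ℕ → ℝ} (hy : ∀ n, 0 ≤ y n)
    (hs : Summable fun n => (b : ℝ) ^ n * y n) :
    ∑' v : List ℕ+, (if ∀ m ∈ v, (m : ℕ) ≤ b then y v.length else 0) =
      ∑' n, (b : ℝ) ^ n * y n := by
  let F : List ℕ+ → ℝ := fun v => if ∀ m ∈ v, (m : ℕ) ≤ b then y v.length else 0
  obtain ⟨B, hB⟩ : ∃ B : ℕ+, (B : ℕ) = b := ⟨⟨b, hb⟩, rfl⟩
  let A : Finset ℕ+ := Finset.Icc 1 B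
  have hA (m : ℕ+) : m ∈ A ↔ (m : ℕ) ≤ b := by
    rw [← hB, PNat.coe_le_coe]
    simp [A]
  have hcard : A.card = b := by simp [A, hB]
  have hF (n : ℕ) (w : Fin n → ℕ+) :
      F (List.ofFn w) = if w ∈ Fintype.piFinset (fun _ => A) then y n else 0 := by
    simp [F, List.mem_ofFn, hA]
  have hin (n : ℕ) : HasSum (fun w : Fin n → ℕ+ => F (List.ofFn w)) ((b : ℝ) ^ n * y n) := by
    have h := hasSum_sum_of_ne_finset_zero (f := fun w : Fin n → ℕ+ => F (List.ofFn w))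
      (s := Fintype.piFinset (fun _ => A)) (L := .unconditional _) (fun w hw => by rw [hF, if_neg hw])
    rw [Finset.sum_congr rfl (fun w hw => by rw [hF, if_pos hw])] at h
    simpa [hcard] using h
  have hF0 (v : List ℕ+) : 0 ≤ F v := by
    simp only [F]; split_ifs <;> simp [hy]
  let G : (Σ n, Fin n → ℕ+) → ℝ := fun p => F (List.ofFn p.2)
  have hG (n : ℕ) : HasSum (fun w => G ⟨n, w⟩) ((b : ℝ) ^ n * y n) := hin n
  have hsum : Summable G := by
    rw [summable_sigma_of_nonneg (fun p => hF0 _)]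
    exact ⟨fun n => (hG n).summable, hs.congr fun n => (hG n).tsum_eq.symm⟩
  calc ∑' v, F v = ∑' p, G p := (List.equivSigmaTuple.symm.tsum_eq F).symm
    _ = ∑' n, ∑' w, G ⟨n, w⟩ := hsum.tsum_sigma' (fun n => (hG n).summable)
    _ = ∑' n, (b : ℝ) ^ n * y n := tsum_congr fun n => (hG n).tsum_eq

/-- Two-sided comparison of `β ^ n / (1 + r + ⋯ + r ^ n)`, `r = β q`, with geometric terms. -/
lemma pow_mul_inv_geom_sum_bounds {β q : ℝ} (hβ : 2 ≤ β) (hq : 1 < q) (n : ℕ) :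
    (β * q - 1) / β * q⁻¹ ^ (n + 1) ≤ β ^ n * (∑ i ∈ Finset.range (n + 1), (β * q) ^ i)⁻¹ ∧
    β ^ n * (∑ i ∈ Finset.range (n + 1), (β * q) ^ i)⁻¹ ≤
      (β * q - 1) / β * q⁻¹ ^ (n + 1) + (β * q - 1) * (1/2) ^ (n + 1) := by
  have hr : 0 < β * q - 1 := by nlinarith
  have hβ0 : 0 < β := by linarith
  have hq0 : 0 < q := by linarith
  have hbn : 1 ≤ β ^ n := one_le_pow₀ (by linarith)
  have hqn : 1 ≤ q ^ (n + 1) := one_le_pow₀ hq.le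
  have h2n : (2 : ℝ) ^ (n + 1) ≤ β ^ (n + 1) := by gcongr
  have hR : β ^ (n + 1) ≤ (β * q) ^ (n + 1) := by
    rw [mul_pow]; exact le_mul_of_one_le_right (by positivity) hqn
  have hbs : 2 * β ^ n ≤ β ^ (n + 1) := by rw [pow_succ]; nlinarith
  have main : (β * q - 1) / β * q⁻¹ ^ (n + 1) = (β * q - 1) * (β ^ n / (β * q) ^ (n + 1)) := by
    rw [mul_pow, inv_pow, pow_succ β]; field_simp
  rw [main, geom_sum_eq (by linarith), inv_div]
  generalize (β * q) ^ (n + 1) = R at *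
  have hR1 : β ^ n ≤ R - 1 := by linarith
  have hR2 : 0 < R - 1 := by linarith
  have hR0 : 0 < R := by linarith
  have e : β ^ n * ((β * q - 1) / (R - 1)) = (β * q - 1) * (β ^ n / (R - 1)) := by ring
  rw [e, ← mul_add]
  constructor
  · gcongr
    linarith
  · gcongr
    have hd : β ^ n / (R - 1) = β ^ n / R + β ^ n / (R * (R - 1)) := by field_simp; ring
    rw [hd]
    gcongr
    rw [one_div_pow, div_le_div_iff₀ (by positivity) (by positivity), one_mul, mul_comm]
    gcongr
    linarith

lemma summable_pow_mul_inv_geom_sum {β q : ℝ} (hβ : 2 ≤ β) (hq : 1 < q) :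
    Summable fun n : ℕ => β ^ n * (∑ i ∈ Finset.range (n + 1), (β * q) ^ i)⁻¹ := by
  have h1 : Summable fun n : ℕ => q⁻¹ ^ (n + 1) :=
    (summable_nat_add_iff 1).2
      (summable_geometric_of_lt_one (by positivity) (inv_lt_one_of_one_lt₀ hq))
  have h2 : Summable fun n : ℕ => (1/2 : ℝ) ^ (n + 1) :=
    (summable_nat_add_iff 1).2 summable_geometric_two
  refine Summable.of_nonneg_of_le (fun n => ?_)
    (fun n => (pow_mul_inv_geom_sum_bounds hβ hq n).2) ((h1.mul_left _).add (h2.mul_left _))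
  positivity

lemma mul_tsum_bounds {β q : ℝ} (hβ : 2 ≤ β) (hq : 1 < q) :
    1 - q⁻¹ / β ≤
      (1 - q⁻¹) * ∑' n : ℕ, β ^ n * (∑ i ∈ Finset.range (n + 1), (β * q) ^ i)⁻¹ ∧
    (1 - q⁻¹) * ∑' n : ℕ, β ^ n * (∑ i ∈ Finset.range (n + 1), (β * q) ^ i)⁻¹ ≤
      1 - q⁻¹ / β + (1 - q⁻¹) * (β * q - 1) := by
  have hq1 : q⁻¹ < 1 := inv_lt_one_of_one_lt₀ hq
  have hq' : 0 < 1 - q⁻¹ := by linarith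
  have h1 : HasSum (fun n : ℕ => q⁻¹ ^ (n + 1)) ((1 - q⁻¹)⁻¹ * q⁻¹) := by
    simpa only [pow_succ] using
      (hasSum_geometric_of_lt_one (r := q⁻¹) (by positivity) hq1).mul_right q⁻¹
  have h2 : HasSum (fun n : ℕ => (1/2 : ℝ) ^ (n + 1)) 1 := by
    simpa [pow_succ] using hasSum_geometric_two.mul_right (1/2 : ℝ)
  have hS := (summable_pow_mul_inv_geom_sum hβ hq).hasSum
  have hl := hasSum_le (fun n => (pow_mul_inv_geom_sum_bounds hβ hq n).1) (h1.mul_left _) hS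
  have hu := hasSum_le (fun n => (pow_mul_inv_geom_sum_bounds hβ hq n).2) hS
    ((h1.mul_left _).add (h2.mul_left _))
  have e : (1 - q⁻¹) * ((β * q - 1) / β * ((1 - q⁻¹)⁻¹ * q⁻¹)) = 1 - q⁻¹ / β := by
    calc _ = ((1 - q⁻¹) * (1 - q⁻¹)⁻¹) * ((β * q - 1) / β * q⁻¹) := by ring
      _ = _ := by
        rw [mul_inv_cancel₀ hq'.ne']
        have : β ≠ 0 := by linarith
        have : q ≠ 0 := by linarith
        field_simp
  rw [← e]
  constructor
  · gcongr
  · refine (mul_le_mul_of_nonneg_left hu hq'.le).trans_eq ?_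
    ring

/-- With the uniform weights `a_i = 1/b` for `1 ≤ i ≤ b` and `a_i = 0` for `i > b`:
`lim_{ε→0+} (1 − d_ε/u_ε) ∑_{v∈𝕌} (1 − f^{(ε)}_v(0)) = 1 − 1/b`; equivalently the reciprocal
`γ_ε` converges to `b/(b−1)`. -/
theorem stmt16 (b : ℕ) (hb : 2 ≤ b) (a : ℕ+ → ℝ)
    (ha : ∀ i : ℕ+, a i = if (i : ℕ) ≤ b then (1 : ℝ) / b else 0) :
    Tendsto (fun ε : ℝ => (1 - (1/2-ε)/(1/2+ε)) * ∑' v : List ℕ+, (1 - fword ε a v 0))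
      (nhdsWithin 0 (Set.Ioo 0 (1/2))) (nhds (1 - 1 / (b : ℝ))) ∧
    Tendsto (fun ε : ℝ =>
        ((1 - (1/2-ε)/(1/2+ε)) * ∑' v : List ℕ+, (1 - fword ε a v 0))⁻¹)
      (nhdsWithin 0 (Set.Ioo 0 (1/2))) (nhds ((b : ℝ) / ((b : ℝ) - 1))) := by
  have hβ : (2 : ℝ) ≤ b := by exact_mod_cast hb
  have hq : Tendsto (fun ε : ℝ => (1/2 + ε) / (1/2 - ε))
      (nhdsWithin 0 (Set.Ioo 0 (1/2))) (nhds 1) := by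
    have : ContinuousAt (fun ε : ℝ => (1/2 + ε) / (1/2 - ε)) 0 :=
      ContinuousAt.div (by fun_prop) (by fun_prop) (by norm_num)
    have h := this.tendsto.mono_left (nhdsWithin_le_nhds (s := Set.Ioo 0 (1/2)))
    simpa using h
  have hqi := hq.inv₀ one_ne_zero
  have hlow : Tendsto (fun ε : ℝ => 1 - ((1/2 + ε) / (1/2 - ε))⁻¹ / b)
      (nhdsWithin 0 (Set.Ioo 0 (1/2))) (nhds (1 - 1 / (b : ℝ))) := by
    simpa using (hqi.div_const (b : ℝ)).const_sub 1
  have hup : Tendsto (fun ε : ℝ => 1 - ((1/2 + ε) / (1/2 - ε))⁻¹ / b +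
      (1 - ((1/2 + ε) / (1/2 - ε))⁻¹) * (b * ((1/2 + ε) / (1/2 - ε)) - 1))
      (nhdsWithin 0 (Set.Ioo 0 (1/2))) (nhds (1 - 1 / (b : ℝ))) := by
    have h := hlow.add ((hqi.const_sub 1).mul ((hq.const_mul (b : ℝ)).sub_const 1))
    rwa [inv_one, sub_self, zero_mul, add_zero] at h
  have hb_ev : ∀ᶠ ε : ℝ in nhdsWithin 0 (Set.Ioo 0 (1/2)),
      1 - ((1/2 + ε) / (1/2 - ε))⁻¹ / b ≤
        (1 - (1/2-ε)/(1/2+ε)) * ∑' v : List ℕ+, (1 - fword ε a v 0) ∧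
      (1 - (1/2-ε)/(1/2+ε)) * ∑' v : List ℕ+, (1 - fword ε a v 0) ≤
        1 - ((1/2 + ε) / (1/2 - ε))⁻¹ / b +
        (1 - ((1/2 + ε) / (1/2 - ε))⁻¹) * (b * ((1/2 + ε) / (1/2 - ε)) - 1) := by
    filter_upwards [self_mem_nhdsWithin] with ε ⟨h0, h1⟩
    have hd : 0 < 1/2 - ε := by linarith
    have hq1 : 1 < (1/2 + ε) / (1/2 - ε) := by rw [one_lt_div hd]; linarith
    simp only [one_sub_fword_zero hb ha h0 h1]
    rw [tsum_words_eq (by omega)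
      (y := fun n => (∑ i ∈ Finset.range (n + 1), (b * ((1/2 + ε) / (1/2 - ε))) ^ i)⁻¹)
      (fun n => by positivity) (summable_pow_mul_inv_geom_sum hβ hq1),
      ← inv_div (1/2 + ε) (1/2 - ε)]
    exact mul_tsum_bounds hβ hq1
  have hmain := tendsto_of_tendsto_of_tendsto_of_le_of_le' hlow hup
    (hb_ev.mono fun _ h => h.1) (hb_ev.mono fun _ h => h.2)
  have hb0 : (b : ℝ) ≠ 0 := by linarith
  have hb1 : (b : ℝ) - 1 ≠ 0 := by linarith
  have e : 1 - 1 / (b : ℝ) = ((b : ℝ) - 1) / b := by field_simp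
  refine ⟨hmain, ?_⟩
  have h := hmain.inv₀ (by rw [e]; exact div_ne_zero hb1 hb0)
  rwa [e, inv_div] at h
end
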